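/- arXiv:1207.0451 — 2 statements merged into one kernel-verified Lean document; each statement's English description precedes it below -/
import Mathlib

section
/- Let G be a group with a finite symmetric generating set S, let 1 < p < ∞, and let (ξ_n) be a sequence of finitely supported probability measures on G with ‖λ_γ ξ_n − ξ_n‖_{ℓ¹(G)} → 0 for every γ ∈ G. Suppose there is K > 0 such that for every n, every s ∈ S, and every p-Dirichlet f : G → ℝ, one has ‖∇_s(ξ_n * f)‖_{ℓ^p(G)} ≤ K · ( Σ_{t∈S} ‖∇_t f‖_{ℓ^p(G)}^p + |f(1)|^p )^{1/p}, where 1 is the identity of G. Then the degree-one reduced ℓ^p-cohomology of (G,S) vanishes: for every p-Dirichlet f : G → ℝ and every ε > 0 there exists h ∈ ℓ^p(G) with ‖∇_s(f − h)‖_{ℓ^p(G)} < ε for every s ∈ S. -/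
open Filter Topology

/-- Word length of `g` with respect to the generating set `S`. -/
noncomputable def wordLength {G : Type*} [Group G] (S : Finset G) (g : G) : ℕ :=
  sInf {n : ℕ | ∃ l : List G, l.length = n ∧ (∀ x ∈ l, x ∈ S) ∧ l.prod = g}

/-- Cayley graph distance `d(x,y) = |y * x⁻¹|`. -/
noncomputable def cayleyDist {G : Type*} [Group G] (S : Finset G) (x y : G) : ℝ :=
  (wordLength S (y * x⁻¹) : ℝ)

/-- Partial gradient `∇ₛ f (x) = f (s⁻¹ x) - f x`. -/
def grad {G : Type*} [Group G] (s : G) (f : G → ℝ) : G → ℝ :=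
  fun x => f (s⁻¹ * x) - f x

/-- `f` is `p`-summable. -/
def MemLp' {G : Type*} (p : ℝ) (f : G → ℝ) : Prop :=
  Summable fun x => |f x| ^ p

/-- The `ℓ^p` norm of `f`. -/
noncomputable def lpNorm {G : Type*} (p : ℝ) (f : G → ℝ) : ℝ :=
  (∑' x, |f x| ^ p) ^ (1 / p)

/-- `f` is `p`-Dirichlet: every partial gradient is in `ℓ^p`. -/
def IsDirichlet {G : Type*} [Group G] (S : Finset G) (p : ℝ) (f : G → ℝ) : Prop :=
  ∀ s ∈ S, MemLp' p (grad s f)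

/-- Convolution `(ξ * f)(x) = ∑ ξ γ • f (γ⁻¹ x)`. -/
noncomputable def conv {G : Type*} [Group G] (ξ f : G → ℝ) : G → ℝ :=
  fun x => ∑' γ, ξ γ * f (γ⁻¹ * x)

/-- A finitely supported probability measure on `G`. -/
def IsProbMeasure {G : Type*} (ξ : G → ℝ) : Prop :=
  (∀ x, 0 ≤ ξ x) ∧ (Function.support ξ).Finite ∧ (∑' x, ξ x) = 1

/-- `ξ^∨ (x) = ξ (x⁻¹)`. -/
def invMeasure {G : Type*} [Group G] (ξ : G → ℝ) : G → ℝ := fun x => ξ x⁻¹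

/-- `(ρ_s ξ^∨)(x) = ξ^∨ (x * s)`. -/
def rhoInvMeasure {G : Type*} [Group G] (ξ : G → ℝ) (s : G) : G → ℝ :=
  fun x => ξ (x * s)⁻¹

/-- `m` is a coupling of `ξ` and `φ`. -/
def IsCoupling {G : Type*} (m : G × G → ℝ) (ξ φ : G → ℝ) : Prop :=
  (∀ z, 0 ≤ m z) ∧ (Function.support m).Finite ∧
    (∀ x, (∑' y, m (x, y)) = ξ x) ∧ (∀ y, (∑' x, m (x, y)) = φ y)

/-- The transportation cost between `ξ` and `φ`, for the Cayley distance of `(G,S)`. -/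
noncomputable def Trc {G : Type*} [Group G] (S : Finset G) (ξ φ : G → ℝ) : ℝ :=
  sInf {c : ℝ | ∃ m, IsCoupling m ξ φ ∧ c = ∑' z : G × G, m z * cayleyDist S z.1 z.2}

/-- `G` is transport amenable (with respect to `S`). -/
def TransportAmenable {G : Type*} [Group G] (S : Finset G) : Prop :=
  ∃ K > (0 : ℝ), ∃ ξ : ℕ → G → ℝ,
    (∀ n, IsProbMeasure (ξ n)) ∧
    (∀ γ : G, Tendsto (fun n => ∑' x, |ξ n (γ⁻¹ * x) - ξ n x|) atTop (𝓝 0)) ∧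
    (∀ s ∈ S, ∀ n, Trc S (rhoInvMeasure (ξ n) s) (invMeasure (ξ n)) ≤ K)
section LpSeminorm

variable {ι : Type*} {p : ℝ}

theorem lpNorm_nonneg (u : ι → ℝ) : 0 ≤ lpNorm p u :=
  Real.rpow_nonneg (tsum_nonneg fun _ => Real.rpow_nonneg (abs_nonneg _) _) _

theorem MemLp'.mono (hp : 0 ≤ p) {u v : ι → ℝ} (hv : MemLp' p v) (h : ∀ i, |u i| ≤ |v i|) :
    MemLp' p u :=
  Summable.of_nonneg_of_le (fun _ => Real.rpow_nonneg (abs_nonneg _) _)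
    (fun i => Real.rpow_le_rpow (abs_nonneg _) (h i) hp) hv

theorem lpNorm_mono (hp : 0 ≤ p) {u v : ι → ℝ} (hv : MemLp' p v) (h : ∀ i, |u i| ≤ |v i|) :
    lpNorm p u ≤ lpNorm p v :=
  Real.rpow_le_rpow (tsum_nonneg fun _ => Real.rpow_nonneg (abs_nonneg _) _)
    (Summable.tsum_le_tsum (fun i => Real.rpow_le_rpow (abs_nonneg _) (h i) hp) (hv.mono hp h) hv)
    (by positivity)

theorem MemLp'.add_and_lpNorm_add_le (hp : 1 ≤ p) {u v : ι → ℝ}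
    (hu : MemLp' p u) (hv : MemLp' p v) :
    MemLp' p (u + v) ∧ lpNorm p (u + v) ≤ lpNorm p u + lpNorm p v := by
  obtain ⟨h₁, h₂⟩ := Real.Lp_add_le_tsum_of_nonneg hp (fun i => abs_nonneg (u i))
    (fun i => abs_nonneg (v i)) hu hv
  have hle : ∀ i, |(u + v) i| ≤ |(|u i| + |v i|)| := fun i =>
    (abs_add_le _ _).trans (le_abs_self _)
  have hm : MemLp' p fun i => |u i| + |v i| :=
    h₁.congr fun i => by rw [abs_of_nonneg (by positivity : 0 ≤ |u i| + |v i|)]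
  refine ⟨hm.mono (by linarith) hle, (lpNorm_mono (by linarith) hm hle).trans ?_⟩
  refine le_of_eq_of_le ?_ h₂
  unfold lpNorm
  congr 2
  ext i
  rw [abs_of_nonneg (by positivity : 0 ≤ |u i| + |v i|)]

theorem MemLp'.add (hp : 1 ≤ p) {u v : ι → ℝ} (hu : MemLp' p u) (hv : MemLp' p v) :
    MemLp' p (u + v) :=
  (hu.add_and_lpNorm_add_le hp hv).1

theorem lpNorm_add_le (hp : 1 ≤ p) {u v : ι → ℝ} (hu : MemLp' p u) (hv : MemLp' p v) :
    lpNorm p (u + v) ≤ lpNorm p u + lpNorm p v :=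
  (hu.add_and_lpNorm_add_le hp hv).2

theorem MemLp'.const_smul {u : ι → ℝ} (hu : MemLp' p u) (c : ℝ) : MemLp' p (c • u) := by
  refine (hu.mul_left (|c| ^ p)).congr fun i => ?_
  rw [Pi.smul_apply, smul_eq_mul, abs_mul, Real.mul_rpow (abs_nonneg _) (abs_nonneg _)]

theorem lpNorm_const_smul (hp : 0 < p) (c : ℝ) (u : ι → ℝ) :
    lpNorm p (c • u) = |c| * lpNorm p u := by
  simp only [lpNorm, Pi.smul_apply, smul_eq_mul, abs_mul,
    Real.mul_rpow (abs_nonneg _) (abs_nonneg _), tsum_mul_left]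
  rw [Real.mul_rpow (by positivity) (tsum_nonneg fun _ => by positivity),
    ← Real.rpow_mul (abs_nonneg _), mul_one_div_cancel hp.ne', Real.rpow_one]

theorem MemLp'.comp_injective {κ : Type*} {u : ι → ℝ} (hu : MemLp' p u) {e : κ → ι}
    (he : Function.Injective e) : MemLp' p (u ∘ e) :=
  Summable.comp_injective (f := fun x => |u x| ^ p) hu he

theorem lpNorm_comp_injective_le (hp : 0 ≤ p) {κ : Type*} {u : ι → ℝ} (hu : MemLp' p u) {e : κ → ι}
    (he : Function.Injective e) : lpNorm p (u ∘ e) ≤ lpNorm p u :=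
  Real.rpow_le_rpow (tsum_nonneg fun _ => by positivity)
    (tsum_comp_le_tsum_of_inj hu (fun _ => by positivity) he) (by positivity)

theorem memLp'_zero (hp : 0 < p) : MemLp' p (0 : ι → ℝ) := by
  simp [MemLp', Real.zero_rpow hp.ne', summable_zero]

theorem memLp'_sum (hp : 1 ≤ p) {κ : Type*} (t : Finset κ) {u : κ → ι → ℝ}
    (h : ∀ k ∈ t, MemLp' p (u k)) : MemLp' p (∑ k ∈ t, u k) :=
  Finset.sum_induction u (MemLp' p) (fun _ _ ha hb => ha.add hp hb)
    (memLp'_zero (by linarith)) h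

theorem tsum_le_rpow_of_lpNorm_le (hp : 0 < p) {u : ι → ℝ} {r : ℝ} (h : lpNorm p u ≤ r) :
    ∑' i, |u i| ^ p ≤ r ^ p := by
  have h0 : 0 ≤ ∑' i, |u i| ^ p := tsum_nonneg fun _ => by positivity
  calc ∑' i, |u i| ^ p = lpNorm p u ^ p := by
        rw [lpNorm, ← Real.rpow_mul h0, one_div_mul_cancel hp.ne', Real.rpow_one]
    _ ≤ r ^ p := Real.rpow_le_rpow (lpNorm_nonneg u) h hp.le

theorem lpNorm_le_of_tsum_le (hp : 0 < p) {u : ι → ℝ} {r : ℝ} (hr : 0 ≤ r)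
    (h : ∑' i, |u i| ^ p ≤ r ^ p) : lpNorm p u ≤ r := by
  refine (Real.rpow_le_rpow (tsum_nonneg fun _ => by positivity) h (by positivity)).trans ?_
  rw [← Real.rpow_mul hr, mul_one_div_cancel hp.ne', Real.rpow_one]

theorem convex_memLp' (hp : 1 ≤ p) : Convex ℝ {u : ι → ℝ | MemLp' p u} :=
  fun _ hu _ hv a b _ _ _ => (hu.const_smul a).add hp (hv.const_smul b)

/-- Two vectors of norm at most `r`, the second of which is small where the first one
concentrates, have a sum of norm at most about `2 ^ (1 / p) * r`. -/
theorem exists_finset_lpNorm_add_le (hp : 1 ≤ p) {r κ : ℝ} (hr : 0 ≤ r) (hκ : 0 < κ) {v : ι → ℝ}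
    (hv : MemLp' p v) (hvr : lpNorm p v ≤ r) :
    ∃ F : Finset ι, ∃ δ > 0, ∀ w : ι → ℝ, MemLp' p w → lpNorm p w ≤ r → (∀ i ∈ F, |w i| ≤ δ) →
      lpNorm p (v + w) ≤ 2 ^ (1 / p) * r + κ := by
  classical
  have hp0 : 0 < p := by linarith
  have hη : 0 < κ ^ p / 2 := by positivity
  obtain ⟨F, hF⟩ := ((tendsto_order.1 hv.hasSum).1 _
    (sub_lt_self (∑' i, |v i| ^ p) hη)).exists
  refine ⟨F, (κ ^ p / 2 / (F.card + 1)) ^ (1 / p), by positivity, fun w hw hwr hwF => ?_⟩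
  have hu_le : ∀ i, |F.piecewise v w i| ^ p ≤ |v i| ^ p + |w i| ^ p := by
    intro i
    by_cases hi : i ∈ F
    · rw [Finset.piecewise_eq_of_mem _ _ _ hi]
      exact le_add_of_nonneg_right (by positivity)
    · rw [Finset.piecewise_eq_of_notMem _ _ _ hi]
      exact le_add_of_nonneg_left (by positivity)
  have hvw : Summable fun i => |v i| ^ p + |w i| ^ p := Summable.add hv hw
  have hu : MemLp' p (F.piecewise v w) := hvw.of_nonneg_of_le (fun _ => by positivity) hu_le
  have hu_norm : lpNorm p (F.piecewise v w) ≤ 2 ^ (1 / p) * r := by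
    refine lpNorm_le_of_tsum_le hp0 (by positivity) ?_
    rw [Real.mul_rpow (by positivity) hr, ← Real.rpow_mul (by norm_num),
      one_div_mul_cancel hp0.ne', Real.rpow_one]
    calc _ ≤ ∑' i, (|v i| ^ p + |w i| ^ p) := Summable.tsum_le_tsum hu_le hu hvw
      _ = ∑' i, |v i| ^ p + ∑' i, |w i| ^ p := Summable.tsum_add hv hw
      _ ≤ r ^ p + r ^ p :=
        add_le_add (tsum_le_rpow_of_lpNorm_le hp0 hvr) (tsum_le_rpow_of_lpNorm_le hp0 hwr)
      _ = 2 * r ^ p := by ring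
  have he_sum : HasSum (fun i => |F.piecewise w v i| ^ p)
      (∑' i, |v i| ^ p + ∑ i ∈ F, (|w i| ^ p - |v i| ^ p)) := by
    have h2 : HasSum (fun i => if i ∈ F then |w i| ^ p - |v i| ^ p else 0)
        (∑ i ∈ F, (|w i| ^ p - |v i| ^ p)) := by
      rw [← Finset.sum_congr rfl fun i hi => if_pos hi]
      exact hasSum_sum_of_ne_finset_zero fun i hi => if_neg hi
    refine (hv.hasSum.add h2).congr_fun ?_
    intro i
    by_cases hi : i ∈ F <;> simp [Finset.piecewise, hi]
  have he : MemLp' p (F.piecewise w v) := he_sum.summable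
  have he_norm : lpNorm p (F.piecewise w v) ≤ κ := by
    refine lpNorm_le_of_tsum_le hp0 hκ.le ?_
    rw [he_sum.tsum_eq, Finset.sum_sub_distrib]
    have hwsum : ∑ i ∈ F, |w i| ^ p ≤ κ ^ p / 2 := by
      calc ∑ i ∈ F, |w i| ^ p ≤ ∑ _i ∈ F, κ ^ p / 2 / (F.card + 1) := by
            refine Finset.sum_le_sum fun i hi => ?_
            refine (Real.rpow_le_rpow (abs_nonneg _) (hwF i hi) hp0.le).trans_eq ?_
            rw [← Real.rpow_mul (by positivity), one_div_mul_cancel hp0.ne', Real.rpow_one]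
        _ = κ ^ p / 2 * (F.card / (F.card + 1)) := by
            rw [Finset.sum_const, nsmul_eq_mul]; ring
        _ ≤ κ ^ p / 2 := by
            refine mul_le_of_le_one_right hη.le ?_
            rw [div_le_one (by positivity)]
            linarith
    linarith
  have hsplit : v + w = F.piecewise v w + F.piecewise w v := by
    ext i
    by_cases hi : i ∈ F <;> simp [Finset.piecewise, hi, add_comm]
  rw [hsplit]
  exact (lpNorm_add_le hp hu he).trans (add_le_add hu_norm he_norm)

/-- A form of Mazur's lemma in `ℓ^p`, `1 < p < ∞`: a bounded sequence that tends to zero pointwise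
has convex combinations of arbitrarily small norm. -/
theorem exists_mem_convexHull_lpNorm_lt (hp : 1 < p) {V : ℕ → ι → ℝ} {M : ℝ}
    (hV : ∀ n, MemLp' p (V n)) (hM : ∀ n, lpNorm p (V n) ≤ M)
    (hlim : ∀ i, Tendsto (fun n => V n i) atTop (𝓝 0)) {ε : ℝ} (hε : 0 < ε) :
    ∃ w ∈ convexHull ℝ (Set.range V), MemLp' p w ∧ lpNorm p w < ε := by
  have hp0 : 0 < p := by linarith
  set a : ℝ := 2 ^ (1 / p) with ha
  have ha0 : 0 < a := by positivity
  have ha2 : a < 2 := by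
    calc a < 2 ^ (1 : ℝ) :=
          Real.rpow_lt_rpow_of_exponent_lt (by norm_num) ((div_lt_one hp0).2 hp)
      _ = 2 := Real.rpow_one 2
  have hmem : ∀ m, ∀ w ∈ convexHull ℝ (V '' Set.Ici m), MemLp' p w := fun m =>
    convexHull_min (by rintro _ ⟨n, -, rfl⟩; exact hV n) (convex_memLp' hp.le)
  have contract : ∀ r > 0, (∀ m, ∃ w ∈ convexHull ℝ (V '' Set.Ici m), lpNorm p w ≤ r) →
      ∀ m, ∃ w ∈ convexHull ℝ (V '' Set.Ici m), lpNorm p w ≤ (a + 2) / 4 * r := by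
    intro r hr h m
    obtain ⟨v, hv, hvr⟩ := h m
    obtain ⟨F, δ, hδ, hF⟩ := exists_finset_lpNorm_add_le hp.le hr.le
      (show 0 < (2 - a) * r / 2 by have := mul_pos (sub_pos.2 ha2) hr; linarith)
      (hmem m v hv) hvr
    have hsmall : ∀ᶠ n in atTop, ∀ i ∈ F, |V n i| ≤ δ := by
      refine (Filter.eventually_all_finset F).2 fun i _ => ?_
      filter_upwards [(tendsto_order.1 (hlim i).abs).2 δ (by simpa using hδ)] with n hn using hn.le
    obtain ⟨N, hN⟩ := eventually_atTop.1 hsmall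
    obtain ⟨w, hw, hwr⟩ := h (max m N)
    have hwF : ∀ i ∈ F, |w i| ≤ δ := by
      have hconv : Convex ℝ {u : ι → ℝ | ∀ i ∈ F, |u i| ≤ δ} := by
        intro x hx y hy b c hb hc hbc i hi
        calc |b * x i + c * y i| ≤ |b * x i| + |c * y i| := abs_add_le _ _
          _ = b * |x i| + c * |y i| := by rw [abs_mul, abs_mul, abs_of_nonneg hb, abs_of_nonneg hc]
          _ ≤ b * δ + c * δ := add_le_add (mul_le_mul_of_nonneg_left (hx i hi) hb)
            (mul_le_mul_of_nonneg_left (hy i hi) hc)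
          _ = δ := by rw [← add_mul, hbc, one_mul]
      refine convexHull_min ?_ hconv hw
      rintro _ ⟨n, hn, rfl⟩
      exact hN n ((le_max_right m N).trans hn)
    refine ⟨(1 / 2 : ℝ) • v + (1 / 2 : ℝ) • w, convex_convexHull ℝ _ hv
      (convexHull_mono (Set.image_mono (Set.Ici_subset_Ici.2 (le_max_left m N))) hw)
      (by norm_num) (by norm_num) (by norm_num), ?_⟩
    rw [← smul_add, lpNorm_const_smul hp0, abs_of_pos (by norm_num)]
    have := hF w (hmem _ w hw) hwr hwF
    rw [← ha] at this
    linarith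
  have hM0 : 0 < |M| + 1 := by positivity
  have iterate : ∀ k : ℕ, ∀ m, ∃ w ∈ convexHull ℝ (V '' Set.Ici m),
      lpNorm p w ≤ ((a + 2) / 4) ^ k * (|M| + 1) := by
    intro k
    induction k with
    | zero =>
      intro m
      refine ⟨V m, subset_convexHull ℝ _ ⟨m, Set.self_mem_Ici, rfl⟩, ?_⟩
      linarith [hM m, le_abs_self M]
    | succ k ih =>
      rw [pow_succ', mul_assoc]
      exact contract _ (by positivity) ih
  obtain ⟨k, hk⟩ := exists_pow_lt_of_lt_one (div_pos hε hM0)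
    (show (a + 2) / 4 < 1 by linarith)
  obtain ⟨w, hw, hwk⟩ := iterate k 0
  exact ⟨w, convexHull_mono (Set.image_subset_range _ _) hw, hmem 0 w hw,
    hwk.trans_lt ((lt_div_iff₀ hM0).1 hk)⟩

end LpSeminorm

section Truncation

variable {ι : Type*}

/-- Truncation of `f` at height `N`. -/
def truncation (f : ι → ℝ) (N : ℝ) : ι → ℝ := fun x => max (min (f x) N) (-N)

theorem abs_truncation_le (f : ι → ℝ) {N : ℝ} (hN : 0 ≤ N) (x : ι) : |truncation f N x| ≤ N :=
  abs_le.2 ⟨le_max_right _ _, max_le (min_le_right _ _) (by linarith)⟩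

theorem truncation_eq_self {f : ι → ℝ} {N : ℝ} {x : ι} (h : |f x| ≤ N) :
    truncation f N x = f x := by
  obtain ⟨h₁, h₂⟩ := abs_le.1 h
  rw [truncation, min_eq_left h₂, max_eq_left h₁]

end Truncation

theorem IsProbMeasure.sum_eq_one {ι : Type*} {ξ : ι → ℝ} (hξ : IsProbMeasure ξ) :
    ∑ γ ∈ hξ.2.1.toFinset, ξ γ = 1 := by
  exact (tsum_eq_sum fun γ hγ => by simpa using hγ).symm.trans hξ.2.2

section Dirichlet

variable {G : Type*} [Group G] {S : Finset G} {p : ℝ}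

theorem grad_add (s : G) (f g : G → ℝ) : grad s (f + g) = grad s f + grad s g := by
  ext x
  simp only [grad, Pi.add_apply]
  ring

theorem IsDirichlet.memLp'_grad (hp : 1 ≤ p) (hgen : Subgroup.closure (S : Set G) = ⊤)
    {f : G → ℝ} (hf : IsDirichlet S p f) (γ : G) : MemLp' p (grad γ f) := by
  have hγ : γ ∈ Subgroup.closure (S : Set G) := hgen ▸ Subgroup.mem_top γ
  induction hγ using Subgroup.closure_induction with
  | mem s hs => exact hf s hs
  | one =>
    convert memLp'_zero (ι := G) (p := p) (by linarith) using 1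
    ext x
    simp [grad]
  | mul a b _ _ ha hb =>
    convert (hb.comp_injective (mul_right_injective a⁻¹)).add hp ha using 1
    ext x
    simp [grad, mul_assoc]
  | inv a _ ha =>
    convert (ha.comp_injective (mul_right_injective a)).const_smul (-1) using 1
    ext x
    simp [grad]

theorem IsProbMeasure.memLp'_sub_conv (hp : 1 ≤ p) (hgen : Subgroup.closure (S : Set G) = ⊤)
    {ξ : G → ℝ} (hξ : IsProbMeasure ξ) {f : G → ℝ} (hf : IsDirichlet S p f) :
    MemLp' p (f - conv ξ f) := by
  have heq : f - conv ξ f = ∑ γ ∈ hξ.2.1.toFinset, (-ξ γ) • grad γ f := by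
    ext x
    have hconv : conv ξ f x = ∑ γ ∈ hξ.2.1.toFinset, ξ γ * f (γ⁻¹ * x) :=
      tsum_eq_sum fun γ hγ => by
        rw [show ξ γ = 0 by simpa using hγ, zero_mul]
    have hfx : f x = ∑ γ ∈ hξ.2.1.toFinset, ξ γ * f x := by
      rw [← Finset.sum_mul, hξ.sum_eq_one, one_mul]
    rw [Pi.sub_apply, hconv, Finset.sum_apply]
    nth_rewrite 1 [hfx]
    rw [← Finset.sum_sub_distrib]
    refine Finset.sum_congr rfl fun γ _ => ?_
    simp only [grad, Pi.smul_apply, smul_eq_mul]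
    ring
  rw [heq]
  exact memLp'_sum hp _ fun γ _ => (hf.memLp'_grad hp hgen γ).const_smul _

theorem IsProbMeasure.abs_grad_conv_le {ξ : G → ℝ} (hξ : IsProbMeasure ξ) {b : G → ℝ} {B : ℝ}
    (hb : ∀ x, |b x| ≤ B) (s x : G) :
    |grad s (conv ξ b) x| ≤ (∑' γ, |ξ (s⁻¹ * γ) - ξ γ|) * B := by
  have hsum : Summable ξ := summable_of_hasFiniteSupport hξ.2.1
  have hsum_s : Summable fun γ => ξ (s⁻¹ * γ) := hsum.comp_injective (mul_right_injective s⁻¹)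
  have hbdd : ∀ {u : G → ℝ}, Summable u → Summable fun γ => u γ * b (γ⁻¹ * x) := fun hu =>
    Summable.of_norm_bounded (hu.abs.mul_right B) fun γ => by
      rw [Real.norm_eq_abs, abs_mul]
      exact mul_le_mul_of_nonneg_left (hb _) (abs_nonneg _)
  have hshift : conv ξ b (s⁻¹ * x) = ∑' γ, ξ (s⁻¹ * γ) * b (γ⁻¹ * x) := by
    rw [conv, ← (Equiv.mulLeft s⁻¹).tsum_eq]
    simp [mul_assoc]
  have heq : grad s (conv ξ b) x = ∑' γ, (ξ (s⁻¹ * γ) - ξ γ) * b (γ⁻¹ * x) := by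
    rw [grad, hshift, conv, ← (hbdd hsum_s).tsum_sub (hbdd hsum)]
    simp only [sub_mul]
  rw [heq, ← tsum_mul_right, ← Real.norm_eq_abs]
  refine tsum_of_norm_bounded (((hsum_s.sub hsum).abs.mul_right B).hasSum) fun γ => ?_
  rw [Real.norm_eq_abs, abs_mul]
  exact mul_le_mul_of_nonneg_left (hb _) (abs_nonneg _)

theorem abs_grad_truncation_le (f : G → ℝ) (N : ℝ) (s x : G) :
    |grad s (truncation f N) x| ≤ |grad s f x| :=
  (abs_max_sub_max_le_abs _ _ _).trans (abs_inf_sub_inf_le_abs _ _ _)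

theorem abs_grad_sub_truncation_le (f : G → ℝ) {N : ℝ} (hN : 0 ≤ N) (s x : G) :
    |grad s (f - truncation f N) x| ≤ |grad s f x| := by
  simp only [grad, truncation, Pi.sub_apply]
  grind

theorem IsDirichlet.truncation (hp : 0 ≤ p) {f : G → ℝ} (hf : IsDirichlet S p f) (N : ℝ) :
    IsDirichlet S p (truncation f N) :=
  fun s hs => (hf s hs).mono hp (abs_grad_truncation_le f N s)

theorem tendsto_lpNorm_grad_sub_truncation (hp : 0 < p) {f : G → ℝ} {s : G}
    (hf : MemLp' p (grad s f)) :
    Tendsto (fun N : ℕ => lpNorm p (grad s (f - truncation f N))) atTop (𝓝 0) := by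
  have key : Tendsto (fun N : ℕ => ∑' x, |grad s (f - truncation f N) x| ^ p) atTop
      (𝓝 (∑' _ : G, (0 : ℝ))) := by
    refine tendsto_tsum_of_dominated_convergence hf (fun x => ?_) (Eventually.of_forall fun N x => ?_)
    · refine tendsto_const_nhds.congr' ?_
      obtain ⟨N₀, hN₀⟩ := exists_nat_ge (max |f x| |f (s⁻¹ * x)|)
      filter_upwards [eventually_ge_atTop N₀] with N hN
      have hN' : max |f x| |f (s⁻¹ * x)| ≤ N := hN₀.trans (Nat.cast_le.2 hN)
      simp [grad, truncation_eq_self ((le_max_left _ _).trans hN'),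
        truncation_eq_self ((le_max_right _ _).trans hN'), Real.zero_rpow hp.ne']
    · rw [Real.norm_of_nonneg (by positivity)]
      exact Real.rpow_le_rpow (abs_nonneg _)
        (abs_grad_sub_truncation_le f N.cast_nonneg s x) hp.le
  rw [tsum_zero] at key
  simpa [lpNorm, Real.zero_rpow (inv_ne_zero hp.ne')] using
    key.rpow_const (p := 1 / p) (Or.inr (by positivity))

/-- The total gradient, as a linear map. -/
def totalGrad (S : Finset G) : (G → ℝ) →ₗ[ℝ] (S × G → ℝ) where
  toFun f := fun i => grad i.1.1 f i.2
  map_add' f g := by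
    ext i
    simp only [grad, Pi.add_apply]
    ring
  map_smul' c f := by
    ext i
    simp only [grad, Pi.smul_apply, smul_eq_mul, RingHom.id_apply]
    ring

theorem IsDirichlet.memLp'_totalGrad {f : G → ℝ} (hf : IsDirichlet S p f) :
    MemLp' p (totalGrad S f) :=
  (summable_prod_of_nonneg fun _ => by simp only [Pi.zero_apply]; positivity).2
    ⟨fun s => hf s s.2, Summable.of_finite⟩

theorem IsDirichlet.lpNorm_totalGrad_le (hp : 0 < p) {f : G → ℝ} (hf : IsDirichlet S p f) {M : ℝ}
    (hM : ∀ s ∈ S, lpNorm p (grad s f) ≤ M) :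
    lpNorm p (totalGrad S f) ≤ (∑ _s : S, M ^ p) ^ (1 / p) := by
  refine Real.rpow_le_rpow (tsum_nonneg fun _ => by positivity) ?_ (by positivity)
  rw [Summable.tsum_prod' hf.memLp'_totalGrad fun s => hf s s.2, tsum_fintype]
  exact Finset.sum_le_sum fun s _ => tsum_le_rpow_of_lpNorm_le hp (hM s s.2)

/-- Bounded Dirichlet functions are approximated in the Dirichlet seminorm by `ℓ^p` functions. -/
theorem IsDirichlet.exists_lpNorm_grad_lt_of_bounded (hp : 1 < p)
    (hgen : Subgroup.closure (S : Set G) = ⊤)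
    {ξ : ℕ → G → ℝ} (hprob : ∀ n, IsProbMeasure (ξ n))
    (hmean : ∀ γ : G, Tendsto (fun n => ∑' x, |ξ n (γ⁻¹ * x) - ξ n x|) atTop (𝓝 0))
    {b : G → ℝ} (hb : IsDirichlet S p b) {B M : ℝ} (hB : ∀ x, |b x| ≤ B)
    (hbξ : ∀ n, IsDirichlet S p (conv (ξ n) b))
    (hM : ∀ n, ∀ s ∈ S, lpNorm p (grad s (conv (ξ n) b)) ≤ M) {ε : ℝ} (hε : 0 < ε) :
    ∃ g : G → ℝ, MemLp' p (b - g) ∧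
      ∀ s ∈ S, MemLp' p (grad s g) ∧ lpNorm p (grad s g) < ε := by
  have hp0 : 0 < p := by linarith
  have hlim : ∀ i : S × G, Tendsto (fun n => totalGrad S (conv (ξ n) b) i) atTop (𝓝 0) := by
    intro i
    refine squeeze_zero_norm (fun n => (hprob n).abs_grad_conv_le hB i.1.1 i.2) ?_
    simpa using (hmean i.1.1).mul_const B
  obtain ⟨w, hw, hw_mem, hw_lt⟩ := exists_mem_convexHull_lpNorm_lt hp
    (V := fun n => totalGrad S (conv (ξ n) b)) (fun n => (hbξ n).memLp'_totalGrad)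
    (fun n => (hbξ n).lpNorm_totalGrad_le hp0 (hM n)) hlim hε
  have hrange : (Set.range fun n => totalGrad S (conv (ξ n) b)) =
      totalGrad S '' Set.range fun n => conv (ξ n) b := Set.range_comp (totalGrad S) _
  rw [hrange, ← LinearMap.image_convexHull] at hw
  obtain ⟨g, hg, rfl⟩ := hw
  have hconv : Convex ℝ {u : G → ℝ | MemLp' p (b - u)} := by
    intro u hu v hv c d hc hd hcd
    have heq : b - (c • u + d • v) = c • (b - u) + d • (b - v) := by
      rw [smul_sub, smul_sub, sub_add_sub_comm, ← add_smul, hcd, one_smul]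
    rw [Set.mem_ofPred_eq, heq]
    exact convex_memLp' hp.le hu hv hc hd hcd
  refine ⟨g, convexHull_min ?_ hconv hg, fun s hs => ?_⟩
  · rintro _ ⟨n, rfl⟩
    exact (hprob n).memLp'_sub_conv hp.le hgen hb
  have hinj : Function.Injective fun x : G => ((⟨s, hs⟩ : S), x) := Prod.mk_right_injective _
  have hgrad : grad s g = totalGrad S g ∘ fun x : G => ((⟨s, hs⟩ : S), x) := rfl
  rw [hgrad]
  exact ⟨hw_mem.comp_injective hinj,
    (lpNorm_comp_injective_le hp0.le hw_mem hinj).trans_lt hw_lt⟩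

end Dirichlet

theorem vanishing_of_reduced_lp_cohomology_of_uniformly_bounded_convolution_operators
    {G : Type*} [Group G] (S : Finset G)
    (hsym : ∀ s ∈ S, s⁻¹ ∈ S) (hgen : Subgroup.closure (S : Set G) = ⊤)
    (p : ℝ) (hp : 1 < p)
    (ξ : ℕ → G → ℝ) (hprob : ∀ n, IsProbMeasure (ξ n))
    (hmean : ∀ γ : G, Tendsto (fun n => ∑' x, |ξ n (γ⁻¹ * x) - ξ n x|) atTop (𝓝 0))
    (K : ℝ) (hK : 0 < K)
    (hbdd : ∀ n, ∀ s ∈ S, ∀ f : G → ℝ, IsDirichlet S p f →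
      MemLp' p (grad s (conv (ξ n) f)) ∧
      lpNorm p (grad s (conv (ξ n) f)) ≤
        K * ((∑ t ∈ S, (lpNorm p (grad t f)) ^ p) + |f 1| ^ p) ^ (1 / p))
    (f : G → ℝ) (hf : IsDirichlet S p f) (ε : ℝ) (hε : 0 < ε) :
    ∃ h : G → ℝ, MemLp' p h ∧ ∀ s ∈ S, lpNorm p (grad s (fun x => f x - h x)) < ε := by
  have hp1 : 1 ≤ p := hp.le
  have hp0 : 0 < p := by linarith
  obtain ⟨N, hN⟩ : ∃ N : ℕ, ∀ s ∈ S, lpNorm p (grad s (f - truncation f N)) < ε / 2 :=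
    ((Filter.eventually_all_finset S).2 fun s hs =>
      (tendsto_order.1 (tendsto_lpNorm_grad_sub_truncation hp0 (hf s hs))).2 _
        (half_pos hε)).exists
  have hb : IsDirichlet S p (truncation f N) := hf.truncation hp0.le N
  obtain ⟨g, hbg, hg⟩ := hb.exists_lpNorm_grad_lt_of_bounded hp hgen hprob hmean
    (abs_truncation_le f N.cast_nonneg) (fun n s hs => (hbdd n s hs _ hb).1)
    (fun n s hs => (hbdd n s hs _ hb).2) (half_pos hε)
  refine ⟨truncation f N - g, hbg, fun s hs => ?_⟩
  have hsplit : (fun x => f x - (truncation f N - g) x) = (f - truncation f N) + g := by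
    ext x
    simp only [Pi.sub_apply, Pi.add_apply]
    ring
  have hfb : MemLp' p (grad s (f - truncation f N)) :=
    (hf s hs).mono hp0.le (abs_grad_sub_truncation_le f N.cast_nonneg s)
  rw [hsplit, grad_add]
  linarith [lpNorm_add_le hp1 hfb (hg s hs).1, hN s hs, (hg s hs).2]
end

section
/- Let G be a group with a finite symmetric generating set S, let ξ be a finitely supported probability measure on G, let s ∈ S, and let K ≥ 0 be such that Trc(ρ_s ξ^∨, ξ^∨) ≤ K. Then for every 1 ≤ p < ∞ and every p-Dirichlet f : G → ℝ, the function ∇_s(ξ * f) is in ℓ^p(G) and ‖∇_s(ξ * f)‖_{ℓ^p(G)} ≤ K · ( Σ_{t∈S} ‖∇_t f‖_{ℓ^p(G)}^p )^{1/p}. -/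
open Filter Topology

/-- `f` lies in `ℓ^p` with norm at most `C`. -/
def LpBound {G : Type*} (p : ℝ) (f : G → ℝ) (C : ℝ) : Prop :=
  MemLp' p f ∧ lpNorm p f ≤ C

namespace LpBound

variable {G ι : Type*} {p : ℝ} {f g : G → ℝ} {A B : ℝ}

theorem zero (hp : 1 ≤ p) : LpBound p (fun _ : G => 0) 0 := by
  have hp0 : p ≠ 0 := by positivity
  have hp1 : p⁻¹ ≠ 0 := inv_ne_zero hp0
  constructor
  · simp [MemLp', Real.zero_rpow hp0]
  · simp [lpNorm, Real.zero_rpow hp0, Real.zero_rpow hp1]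

theorem add (hp : 1 ≤ p) (hf : LpBound p f A) (hg : LpBound p g B) :
    LpBound p (fun x => f x + g x) (A + B) := by
  have hadd := Real.Lp_add_le_tsum_of_nonneg hp (fun x => abs_nonneg (f x))
    (fun x => abs_nonneg (g x)) hf.1 hg.1
  have hle : ∀ x, |f x + g x| ^ p ≤ (|f x| + |g x|) ^ p := fun x =>
    Real.rpow_le_rpow (abs_nonneg _) (abs_add_le _ _) (by positivity)
  have hsum : MemLp' p fun x => f x + g x :=
    Summable.of_nonneg_of_le (fun x => by positivity) hle hadd.1
  refine ⟨hsum, ?_⟩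
  calc lpNorm p (fun x => f x + g x)
      ≤ (∑' x, (|f x| + |g x|) ^ p) ^ (1 / p) :=
        Real.rpow_le_rpow (tsum_nonneg fun x => by positivity)
          (hsum.tsum_le_tsum hle hadd.1) (by positivity)
    _ ≤ lpNorm p f + lpNorm p g := hadd.2
    _ ≤ A + B := add_le_add hf.2 hg.2

theorem const_mul (hp : 1 ≤ p) {c : ℝ} (hc : 0 ≤ c) (hf : LpBound p f A) :
    LpBound p (fun x => c * f x) (c * A) := by
  have hp0 : p ≠ 0 := by positivity
  have h : ∀ x, |c * f x| ^ p = c ^ p * |f x| ^ p := fun x => by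
    rw [abs_mul, abs_of_nonneg hc, Real.mul_rpow hc (abs_nonneg _)]
  refine ⟨by simpa only [MemLp', h] using Summable.mul_left (c ^ p) hf.1, ?_⟩
  have hn : lpNorm p (fun x => c * f x) = c * lpNorm p f := by
    simp only [lpNorm, h, tsum_mul_left]
    rw [Real.mul_rpow (by positivity) (tsum_nonneg fun x => by positivity), one_div,
      Real.rpow_rpow_inv hc hp0]
  rw [hn]
  exact mul_le_mul_of_nonneg_left hf.2 hc

theorem sum (hp : 1 ≤ p) (s : Finset ι) {F : ι → G → ℝ} {C : ι → ℝ}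
    (h : ∀ i ∈ s, LpBound p (F i) (C i)) :
    LpBound p (fun x => ∑ i ∈ s, F i x) (∑ i ∈ s, C i) := by
  classical
  induction s using Finset.induction_on with
  | empty => simpa using zero hp
  | insert a s ha ih =>
    simp only [Finset.sum_insert ha]
    exact (h a (Finset.mem_insert_self _ _)).add hp
      (ih fun i hi => h i (Finset.mem_insert_of_mem hi))

theorem comp_equiv (e : G ≃ G) (hf : LpBound p f A) : LpBound p (fun x => f (e x)) A := by
  refine ⟨(e.summable_iff (f := fun x => |f x| ^ p)).2 hf.1, ?_⟩
  simpa only [lpNorm, e.tsum_eq fun x => |f x| ^ p] using hf.2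

end LpBound

section Measure

variable {G : Type*}

theorem lpNorm_nonneg_s9 {p : ℝ} (f : G → ℝ) : 0 ≤ lpNorm p f :=
  Real.rpow_nonneg (tsum_nonneg fun _ => by positivity) _

theorem IsCoupling.tsum_mul_sub {m : G × G → ℝ} {μ ν : G → ℝ} (hm : IsCoupling m μ ν)
    (u : G → ℝ) :
    ∑' z, m z * (u z.1 - u z.2) = (∑' a, μ a * u a) - ∑' b, ν b * u b := by
  obtain ⟨-, hfin, h1, h2⟩ := hm
  have hs : ∀ v : G × G → ℝ, Summable fun z => m z * v z := fun v =>
    summable_of_hasFiniteSupport (hfin.subset (Function.support_mul_subset_left m v))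
  have hfst : ∑' z, m z * u z.1 = ∑' a, μ a * u a := by
    rw [(hs fun z => u z.1).tsum_prod]
    simp only [tsum_mul_right, h1]
  have hsnd : ∑' z, m z * u z.2 = ∑' b, ν b * u b := by
    have hswap : Summable fun z : G × G => m z.swap * u z.swap.2 :=
      (Equiv.prodComm G G).summable_iff.2 (hs fun z => u z.2)
    rw [← (Equiv.prodComm G G).tsum_eq]
    simp only [Equiv.prodComm_apply]
    rw [hswap.tsum_prod]
    simp only [Prod.swap_prod_mk, tsum_mul_right, h2]
  simp only [mul_sub]
  rw [(hs fun z => u z.1).tsum_sub (hs fun z => u z.2), hfst, hsnd]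

theorem IsProbMeasure.comp_equiv {ξ : G → ℝ} (hξ : IsProbMeasure ξ) (e : G ≃ G) :
    IsProbMeasure fun x => ξ (e x) :=
  ⟨fun _ => hξ.1 _, hξ.2.1.preimage e.injective.injOn, (e.tsum_eq ξ).trans hξ.2.2⟩

theorem IsProbMeasure.isCoupling_prod {μ ν : G → ℝ} (hμ : IsProbMeasure μ)
    (hν : IsProbMeasure ν) : IsCoupling (fun z => μ z.1 * ν z.2) μ ν := by
  refine ⟨fun z => mul_nonneg (hμ.1 _) (hν.1 _), (hμ.2.1.prod hν.2.1).subset fun z hz => ?_,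
    fun x => ?_, fun y => ?_⟩
  · exact ⟨left_ne_zero_of_mul hz, right_ne_zero_of_mul hz⟩
  · simp [tsum_mul_left, hν.2.2]
  · simp [tsum_mul_right, hμ.2.2]

end Measure

section Cayley

variable {G : Type*} [Group G] {S : Finset G}

theorem exists_list_length_eq_wordLength (hsym : ∀ s ∈ S, s⁻¹ ∈ S)
    (hgen : Subgroup.closure (S : Set G) = ⊤) (g : G) :
    ∃ l : List G, l.length = wordLength S g ∧ (∀ x ∈ l, x ∈ S) ∧ l.prod = g := by
  have hmem : g ∈ (Subgroup.closure (S : Set G)).toSubmonoid := by simp [hgen]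
  rw [Subgroup.closure_toSubmonoid] at hmem
  obtain ⟨l, hl, hg⟩ := Submonoid.exists_list_of_mem_closure hmem
  have hne : {n : ℕ | ∃ l : List G, l.length = n ∧ (∀ x ∈ l, x ∈ S) ∧ l.prod = g}.Nonempty :=
    ⟨_, l, rfl, fun x hx => (hl x hx).elim id fun h => by simpa using hsym _ h, hg⟩
  exact Nat.sInf_mem hne

theorem LpBound.list_prod_mul_sub {p D : ℝ} (hp : 1 ≤ p) (hsym : ∀ s ∈ S, s⁻¹ ∈ S)
    {f : G → ℝ} (hf : ∀ t ∈ S, LpBound p (grad t f) D) (y : G) (l : List G)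
    (hl : ∀ x ∈ l, x ∈ S) :
    LpBound p (fun x => f (l.prod * y * x) - f (y * x)) (l.length * D) := by
  induction l with
  | nil => simpa using LpBound.zero hp
  | cons t l ih =>
    have ht := (hf _ (hsym t (hl t (by simp)))).comp_equiv (Equiv.mulLeft (l.prod * y))
    have h := ht.add hp (ih fun x hx => hl x (by simp [hx]))
    convert h using 1
    · funext x
      simp [grad, mul_assoc]
    · push_cast [List.length_cons]
      ring

theorem LpBound.translate_sub {p D : ℝ} (hp : 1 ≤ p) (hsym : ∀ s ∈ S, s⁻¹ ∈ S)
    (hgen : Subgroup.closure (S : Set G) = ⊤)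
    {f : G → ℝ} (hf : ∀ t ∈ S, LpBound p (grad t f) D) (a b : G) :
    LpBound p (fun x => f (a * x) - f (b * x)) (cayleyDist S a b * D) := by
  obtain ⟨l, hlen, hl, hprod⟩ := exists_list_length_eq_wordLength hsym hgen (b * a⁻¹)
  have h := LpBound.list_prod_mul_sub hp hsym hf a l hl
  simp only [hlen, hprod, inv_mul_cancel_right] at h
  unfold LpBound MemLp' lpNorm at h ⊢
  simp only [abs_sub_comm (f (a * _))]
  exact h

theorem lpNorm_grad_le {p : ℝ} (hp : 1 ≤ p) (f : G → ℝ) {t : G} (ht : t ∈ S) :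
    lpNorm p (grad t f) ≤ (∑ t ∈ S, (lpNorm p (grad t f)) ^ p) ^ (1 / p) := by
  have hp0 : p ≠ 0 := by positivity
  have hnn : ∀ i ∈ S, 0 ≤ lpNorm p (grad i f) ^ p := fun i _ =>
    Real.rpow_nonneg (lpNorm_nonneg_s9 _) _
  calc lpNorm p (grad t f) = (lpNorm p (grad t f) ^ p) ^ (1 / p) := by
        rw [one_div, Real.rpow_rpow_inv (lpNorm_nonneg_s9 _) hp0]
    _ ≤ _ := Real.rpow_le_rpow (hnn t ht) (Finset.single_le_sum hnn ht) (by positivity)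

theorem grad_conv (ξ f : G → ℝ) (s x : G) :
    grad s (conv ξ f) x =
      (∑' a, rhoInvMeasure ξ s a * f (a * x)) - ∑' b, invMeasure ξ b * f (b * x) := by
  simp only [grad, conv, rhoInvMeasure, invMeasure]
  congr 1
  · rw [← ((Equiv.mulRight s).trans (Equiv.inv G)).tsum_eq]
    simp [mul_assoc]
  · rw [← (Equiv.inv G).tsum_eq]
    simp

theorem LpBound.grad_conv_of_isCoupling {p D : ℝ} (hp : 1 ≤ p) (hsym : ∀ s ∈ S, s⁻¹ ∈ S)
    (hgen : Subgroup.closure (S : Set G) = ⊤) {ξ f : G → ℝ} {s : G}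
    (hf : ∀ t ∈ S, LpBound p (grad t f) D) {m : G × G → ℝ}
    (hm : IsCoupling m (rhoInvMeasure ξ s) (invMeasure ξ)) :
    LpBound p (grad s (conv ξ f)) ((∑' z : G × G, m z * cayleyDist S z.1 z.2) * D) := by
  have hsum : ∀ v : G × G → ℝ, ∑' z, m z * v z = ∑ z ∈ hm.2.1.toFinset, m z * v z := fun v =>
    tsum_eq_sum fun z hz => by
      have : m z = 0 := by simpa using hz
      simp [this]
  have hgrad : grad s (conv ξ f) = fun x =>
      ∑ z ∈ hm.2.1.toFinset, m z * (f (z.1 * x) - f (z.2 * x)) := by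
    funext x
    rw [grad_conv, ← hm.tsum_mul_sub fun a => f (a * x), hsum]
  rw [hgrad, hsum, Finset.sum_mul]
  simp only [mul_assoc]
  exact LpBound.sum hp _ fun z _ =>
    (LpBound.translate_sub hp hsym hgen hf z.1 z.2).const_mul hp (hm.1 z)

end Cayley

theorem lp_bound_of_transport_cost_bound
    {G : Type*} [Group G] (S : Finset G)
    (hsym : ∀ s ∈ S, s⁻¹ ∈ S) (hgen : Subgroup.closure (S : Set G) = ⊤)
    (ξ : G → ℝ) (hξ : IsProbMeasure ξ) (s : G) (hs : s ∈ S)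
    (K : ℝ) (hK : 0 ≤ K) (htrc : Trc S (rhoInvMeasure ξ s) (invMeasure ξ) ≤ K)
    (p : ℝ) (hp : 1 ≤ p) (f : G → ℝ) (hf : IsDirichlet S p f) :
    MemLp' p (grad s (conv ξ f)) ∧
      lpNorm p (grad s (conv ξ f)) ≤ K * ((∑ t ∈ S, (lpNorm p (grad t f)) ^ p) ^ (1 / p)) := by
  set D := (∑ t ∈ S, (lpNorm p (grad t f)) ^ p) ^ (1 / p) with hD
  have hD0 : 0 ≤ D := (lpNorm_nonneg_s9 _).trans (lpNorm_grad_le hp f hs)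
  have hbound : ∀ t ∈ S, LpBound p (grad t f) D := fun t ht =>
    ⟨hf t ht, lpNorm_grad_le hp f ht⟩
  have hcost := fun {m} => LpBound.grad_conv_of_isCoupling (m := m) hp hsym hgen (ξ := ξ)
    (s := s) hbound
  have hprod : IsCoupling _ (rhoInvMeasure ξ s) (invMeasure ξ) :=
    (hξ.comp_equiv ((Equiv.mulRight s).trans (Equiv.inv G))).isCoupling_prod
      (hξ.comp_equiv (Equiv.inv G))
  refine ⟨(hcost hprod).1, le_trans ?_ (mul_le_mul_of_nonneg_right htrc hD0)⟩
  rcases hD0.eq_or_lt with h0 | hpos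
  · simpa [← h0] using (hcost hprod).2
  · rw [← div_le_iff₀ hpos]
    refine le_csInf ⟨_, _, hprod, rfl⟩ ?_
    rintro c ⟨m, hm, rfl⟩
    exact (div_le_iff₀ hpos).2 (hcost hm).2
end
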